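/- (Theorem 1) For each fixed n ≥ 1, the best packing efficiency η₀, viewed as a map ℝ_{>0}^{2n} → [0,1] sending (w₁, l₁, …, wₙ, lₙ) to η₀ of the corresponding family of n rectangles, is continuous. -/

import Mathlib

open Set Finset Function

/-- A positioning of a family of rectangles (widths `w`, heights `l`) assigns
lower-left corners `(a i, b i)` so that the open interiors are pairwise disjoint. -/
def IsPositioning {ι : Type*} (w l a b : ι → ℝ) : Prop :=
  ∀ i j, i ≠ j →
    Disjoint (Set.Ioo (a i) (a i + w i) ×ˢ Set.Ioo (b i) (b i + l i))
             (Set.Ioo (a j) (a j + w j) ×ˢ Set.Ioo (b j) (b j + l j))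

/-- Horizontal extent `p(M) = max_{i,j} ((a i + w i) - a j)`. -/
noncomputable def pval {n : ℕ} (w a : Fin n → ℝ) : ℝ :=
  ⨆ i, ⨆ j, (a i + w i - a j)

/-- Vertical extent `q(M) = max_{i,j} ((b i + l i) - b j)`. -/
noncomputable def qval {n : ℕ} (l b : Fin n → ℝ) : ℝ :=
  ⨆ i, ⨆ j, (b i + l i - b j)

/-- Bounding area `T(M) = p(M) * q(M)`. -/
noncomputable def Tval {n : ℕ} (w l a b : Fin n → ℝ) : ℝ :=
  pval w a * qval l b

/-- Total area `S(A) = ∑ i, w i * l i`. -/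
noncomputable def Sval {n : ℕ} (w l : Fin n → ℝ) : ℝ :=
  ∑ i, w i * l i

/-- Packing efficiency `η(M) = S(A) / T(M)`. -/
noncomputable def eta {n : ℕ} (w l a b : Fin n → ℝ) : ℝ :=
  Sval w l / Tval w l a b

/-- Best packing efficiency `η₀(A) = sup over positionings M of η(M)`. -/
noncomputable def eta0 {n : ℕ} (w l : Fin n → ℝ) : ℝ :=
  sSup {e | ∃ a b : Fin n → ℝ, IsPositioning w l a b ∧ e = eta w l a b}

/-- Minimal bounding area `T₀(A) = inf over positionings M of T(M)`. -/
noncomputable def T0 {n : ℕ} (w l : Fin n → ℝ) : ℝ :=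
  sInf {t | ∃ a b : Fin n → ℝ, IsPositioning w l a b ∧ t = Tval w l a b}

section Extents

variable {n : ℕ}

theorem le_pval (w a : Fin n → ℝ) (i j : Fin n) : a i + w i - a j ≤ pval w a :=
  (le_ciSup (f := fun j => a i + w i - a j) (Set.finite_range _).bddAbove j).trans
    (le_ciSup (f := fun i => ⨆ j, (a i + w i - a j)) (Set.finite_range _).bddAbove i)

/-- The horizontal and vertical extents are the same functional. -/
theorem qval_eq_pval (l b : Fin n → ℝ) : qval l b = pval l b := rfl

theorem pval_pos {w : Fin (n + 1) → ℝ} (hw : ∀ i, 0 < w i) (a : Fin (n + 1) → ℝ) :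
    0 < pval w a := by
  have := le_pval w a 0 0
  linarith [hw 0]

/-- All the intervals of a family lie in one interval whose length is the extent. -/
theorem exists_Ioo_subset_Ioo_pval (w a : Fin (n + 1) → ℝ) :
    ∃ c, ∀ i, Set.Ioo (a i) (a i + w i) ⊆ Set.Ioo c (c + pval w a) := by
  obtain ⟨j, hj⟩ := Finite.exists_min a
  refine ⟨a j, fun i => Set.Ioo_subset_Ioo (hj i) ?_⟩
  linarith [le_pval w a i j]

theorem pval_smul_le {c : ℝ} (hc : 0 ≤ c) {w w' : Fin (n + 1) → ℝ} (h : ∀ i, w' i ≤ c * w i)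
    (a : Fin (n + 1) → ℝ) : pval w' (c • a) ≤ c * pval w a := by
  refine ciSup_le fun i => ciSup_le fun j => ?_
  have := mul_le_mul_of_nonneg_left (le_pval w a i j) hc
  simp only [Pi.smul_apply, smul_eq_mul]
  linarith [h i]

theorem Tval_pos {w l : Fin (n + 1) → ℝ} (hw : ∀ i, 0 < w i) (hl : ∀ i, 0 < l i)
    (a b : Fin (n + 1) → ℝ) : 0 < Tval w l a b :=
  mul_pos (pval_pos hw a) (pval_pos hl b)

theorem Sval_nonneg {w l : Fin n → ℝ} (hw : ∀ i, 0 < w i) (hl : ∀ i, 0 < l i) :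
    0 ≤ Sval w l :=
  Finset.sum_nonneg fun i _ => (mul_pos (hw i) (hl i)).le

end Extents

/-- Dilating a positioning by `c` leaves room for any rectangles at most `c` times as large. -/
theorem IsPositioning.smul {ι : Type*} {w l w' l' a b : ι → ℝ} (h : IsPositioning w l a b)
    {c : ℝ} (hc : 0 < c) (hw : ∀ i, w' i ≤ c * w i) (hl : ∀ i, l' i ≤ c * l i) :
    IsPositioning w' l' (c • a) (c • b) := by
  have scale : ∀ {x s t t' : ℝ}, t' ≤ c * t → x ∈ Set.Ioo (c * s) (c * s + t') →
      c⁻¹ * x ∈ Set.Ioo s (s + t) := by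
    intro x s t t' ht hx
    rw [Set.mem_Ioo, lt_inv_mul_iff₀ hc, inv_mul_lt_iff₀ hc]
    exact ⟨hx.1, by linarith [hx.2]⟩
  intro i j hij
  rw [Set.disjoint_left]
  rintro ⟨x, y⟩ ⟨hxi, hyi⟩ ⟨hxj, hyj⟩
  exact Set.disjoint_left.1 (h i j hij)
    (show (c⁻¹ * x, c⁻¹ * y) ∈ _ from ⟨scale (hw i) hxi, scale (hl i) hyi⟩)
    ⟨scale (hw j) hxj, scale (hl j) hyj⟩

section Efficiency

variable {n : ℕ} {w l w' l' a b : Fin (n + 1) → ℝ}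

open MeasureTheory in
theorem IsPositioning.Sval_le_Tval (hw : ∀ i, 0 < w i) (hl : ∀ i, 0 < l i)
    (h : IsPositioning w l a b) : Sval w l ≤ Tval w l a b := by
  obtain ⟨c, hc⟩ := exists_Ioo_subset_Ioo_pval w a
  obtain ⟨d, hd⟩ := exists_Ioo_subset_Ioo_pval l b
  have vol : ∀ s t u v : ℝ, 0 ≤ t →
      volume (Set.Ioo s (s + t) ×ˢ Set.Ioo u (u + v)) = ENNReal.ofReal (t * v) := by
    intro s t u v ht
    rw [Measure.volume_eq_prod, Measure.prod_prod, Real.volume_Ioo, Real.volume_Ioo,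
      ENNReal.ofReal_mul ht, add_sub_cancel_left, add_sub_cancel_left]
  have key : ∑ i, volume (Set.Ioo (a i) (a i + w i) ×ˢ Set.Ioo (b i) (b i + l i)) ≤
      volume (Set.Ioo c (c + pval w a) ×ˢ Set.Ioo d (d + pval l b)) := by
    rw [← measure_biUnion_finset (fun i _ j _ hij => h i j hij)
      (fun i _ => measurableSet_Ioo.prod measurableSet_Ioo)]
    exact measure_mono (Set.iUnion₂_subset fun i _ => Set.prod_mono (hc i) (hd i))
  simp only [vol _ _ _ _ (hw _).le, vol _ _ _ _ (pval_pos hw a).le] at key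
  rw [← ENNReal.ofReal_sum_of_nonneg fun i _ => (mul_pos (hw i) (hl i)).le] at key
  exact (ENNReal.ofReal_le_ofReal_iff (Tval_pos hw hl a b).le).1 key

theorem IsPositioning.eta_le_one (hw : ∀ i, 0 < w i) (hl : ∀ i, 0 < l i)
    (h : IsPositioning w l a b) : eta w l a b ≤ 1 :=
  (div_le_one (Tval_pos hw hl a b)).2 (h.Sval_le_Tval hw hl)

theorem IsPositioning.eta_le_eta0 (hw : ∀ i, 0 < w i) (hl : ∀ i, 0 < l i)
    (h : IsPositioning w l a b) : eta w l a b ≤ eta0 w l := by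
  refine le_csSup ⟨1, ?_⟩ ⟨a, b, h, rfl⟩
  rintro _ ⟨a', b', h', rfl⟩
  exact h'.eta_le_one hw hl

theorem eta0_mem_Icc (hw : ∀ i, 0 < w i) (hl : ∀ i, 0 < l i) :
    eta0 w l ∈ Set.Icc (0 : ℝ) 1 := by
  constructor
  · refine Real.sSup_nonneg ?_
    rintro _ ⟨a, b, -, rfl⟩
    exact div_nonneg (Sval_nonneg hw hl) (Tval_pos hw hl a b).le
  · refine Real.sSup_le ?_ zero_le_one
    rintro _ ⟨a, b, h, rfl⟩
    exact h.eta_le_one hw hl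

theorem Sval_le_of_le_mul {c : ℝ} (hc : 0 ≤ c) (hl : ∀ i, 0 < l i) (hw' : ∀ i, 0 < w' i)
    (hww' : ∀ i, w i ≤ c * w' i) (hll' : ∀ i, l i ≤ c * l' i) :
    Sval w l ≤ c ^ 2 * Sval w' l' := by
  rw [Sval, Sval, Finset.mul_sum]
  refine Finset.sum_le_sum fun i _ => ?_
  calc w i * l i ≤ (c * w' i) * (c * l' i) :=
        mul_le_mul (hww' i) (hll' i) (hl i).le (mul_nonneg hc (hw' i).le)
    _ = c ^ 2 * (w' i * l' i) := by ring

theorem Tval_smul_le {c : ℝ} (hc : 0 ≤ c) (hw : ∀ i, 0 < w i) (hl' : ∀ i, 0 < l' i)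
    (hw'w : ∀ i, w' i ≤ c * w i) (hl'l : ∀ i, l' i ≤ c * l i) :
    Tval w' l' (c • a) (c • b) ≤ c ^ 2 * Tval w l a b := by
  calc Tval w' l' (c • a) (c • b) ≤ (c * pval w a) * (c * pval l b) :=
        mul_le_mul (pval_smul_le hc hw'w a) (pval_smul_le hc hl'l b) (pval_pos hl' _).le
          (mul_nonneg hc (pval_pos hw a).le)
    _ = c ^ 2 * Tval w l a b := by rw [Tval, qval_eq_pval]; ring

/-- If corresponding sides of two families agree up to a factor `c`, then their best packing
efficiencies agree up to a factor `c ^ 4`. -/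
theorem eta0_le_pow_four_mul_eta0 {c : ℝ} (hc : 0 < c) (hw : ∀ i, 0 < w i) (hl : ∀ i, 0 < l i)
    (hw' : ∀ i, 0 < w' i) (hl' : ∀ i, 0 < l' i)
    (hww' : ∀ i, w i ≤ c * w' i) (hll' : ∀ i, l i ≤ c * l' i)
    (hw'w : ∀ i, w' i ≤ c * w i) (hl'l : ∀ i, l' i ≤ c * l i) :
    eta0 w l ≤ c ^ 4 * eta0 w' l' := by
  refine Real.sSup_le ?_ (mul_nonneg (by positivity) (eta0_mem_Icc hw' hl').1)
  rintro _ ⟨a, b, h, rfl⟩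
  refine le_trans ?_ (mul_le_mul_of_nonneg_left
    ((h.smul hc hw'w hl'l).eta_le_eta0 hw' hl') (by positivity))
  rw [eta, eta, ← mul_div_assoc, div_le_div_iff₀ (Tval_pos hw hl a b) (Tval_pos hw' hl' _ _)]
  calc Sval w l * Tval w' l' (c • a) (c • b)
      ≤ (c ^ 2 * Sval w' l') * (c ^ 2 * Tval w l a b) :=
        mul_le_mul (Sval_le_of_le_mul hc.le hl hw' hww' hll')
          (Tval_smul_le hc.le hw hl' hw'w hl'l) (Tval_pos hw' hl' _ _).le
          (mul_nonneg (by positivity) (Sval_nonneg hw' hl'))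
    _ = c ^ 4 * Sval w' l' * Tval w l a b := by ring

end Efficiency

open Topology in
/-- A family of positive reals varying near `u x` stays within any factor `c > 1` of it. -/
theorem eventually_le_mul_and_le_mul {X ι : Type*} [TopologicalSpace X] [Finite ι]
    {u : X → ι → ℝ} {x : X} (hu : ContinuousAt u x) (hx : ∀ i, 0 < u x i) {c : ℝ} (hc : 1 < c) :
    ∀ᶠ y in 𝓝 x, (∀ i, u y i ≤ c * u x i) ∧ ∀ i, u x i ≤ c * u y i := by
  have hui := fun i => (continuousAt_pi.1 hu) i
  refine (Filter.eventually_all.2 fun i => ?_).and (Filter.eventually_all.2 fun i => ?_)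
  · exact ((hui i).eventually_lt continuousAt_const
      (lt_mul_of_one_lt_left (hx i) hc)).mono fun _ h => h.le
  · exact (continuousAt_const.eventually_lt (continuousAt_const.mul (hui i))
      (lt_mul_of_one_lt_left (hx i) hc)).mono fun _ h => h.le

open Topology in
theorem exists_one_lt_pow_lt (m : ℕ) {r : ℝ} (hr : 1 < r) : ∃ c : ℝ, 1 < c ∧ c ^ m < r := by
  have h : ∀ᶠ c : ℝ in 𝓝[>] 1, c ^ m < r :=
    ((continuous_pow m).continuousAt.eventually_lt continuousAt_const
      (by simpa using hr)).filter_mono nhdsWithin_le_nhds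
  exact (eventually_mem_nhdsWithin.and h).exists

/-- Theorem 1: for each fixed `n ≥ 1`, the best packing efficiency `η₀` is a
continuous map from `ℝ_{>0}^{2n}` to `[0, 1]`. -/
theorem eta0_continuousOn {n : ℕ} :
    ContinuousOn
      (fun A : (Fin (n + 1) → ℝ) × (Fin (n + 1) → ℝ) => eta0 A.1 A.2)
      {A : (Fin (n + 1) → ℝ) × (Fin (n + 1) → ℝ) |
        (∀ i, 0 < A.1 i) ∧ (∀ i, 0 < A.2 i)} ∧
    ∀ A : (Fin (n + 1) → ℝ) × (Fin (n + 1) → ℝ),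
      (∀ i, 0 < A.1 i) → (∀ i, 0 < A.2 i) → eta0 A.1 A.2 ∈ Set.Icc (0 : ℝ) 1 := by
  refine ⟨?_, fun A => eta0_mem_Icc⟩
  rintro A ⟨hw, hl⟩
  refine Metric.tendsto_nhds.2 fun ε hε => ?_
  obtain ⟨c, hc, hcε⟩ := exists_one_lt_pow_lt 4 (lt_add_of_pos_right 1 hε)
  have hc0 : 0 < c := one_pos.trans hc
  filter_upwards [self_mem_nhdsWithin,
    nhdsWithin_le_nhds (eventually_le_mul_and_le_mul continuous_fst.continuousAt hw hc),
    nhdsWithin_le_nhds (eventually_le_mul_and_le_mul continuous_snd.continuousAt hl hc)]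
    with B ⟨hw', hl'⟩ ⟨h₁, h₂⟩ ⟨h₃, h₄⟩
  have hBA := eta0_le_pow_four_mul_eta0 hc0 hw' hl' hw hl h₁ h₃ h₂ h₄
  have hAB := eta0_le_pow_four_mul_eta0 hc0 hw hl hw' hl' h₂ h₄ h₁ h₃
  have hc4 : 0 ≤ c ^ 4 - 1 := sub_nonneg.2 (one_le_pow₀ hc.le)
  have hA := mul_le_of_le_one_right hc4 (eta0_mem_Icc hw hl).2
  have hB := mul_le_of_le_one_right hc4 (eta0_mem_Icc hw' hl').2
  rw [Real.dist_eq, abs_lt]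
  constructor <;> linarith
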